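/- arXiv:1507.05661 — 2 statements merged into one kernel-verified Lean document; each statement's English description precedes it below -/
import Mathlib

section
/- Let q ≥ 2 and let O be the set of Z ∈ so(q,ℝ) such that the eigenvalues of Z are distinct (the characteristic polynomial of Z has q distinct roots in ℂ) and such that for any two distinct nonzero eigenvalues λ, μ of Z the ratio λ/μ is not an integer of absolute value ≥ 2. Let W be a finite-dimensional subspace of so(q,ℝ) such that W ∩ O is nonempty. Then W ∩ O is open in the subspace topology of W, and W ∖ (W ∩ O) has measure zero with respect to the Haar (Lebesgue) measure on the finite-dimensional real vector space W. -/
open Matrix MeasureTheory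

noncomputable section

/-- The multiset of eigenvalues (in ℂ) of a real matrix: the roots of its characteristic
polynomial over ℂ. -/
def eigs {q : ℕ} (Z : Matrix (Fin q) (Fin q) ℝ) : Multiset ℂ :=
  (Z.charpoly.map (algebraMap ℝ ℂ)).roots

/-- The (Borel) measurable structure on matrices, given entrywise. -/
instance matrixMeasurableSpace {m n α : Type*} [MeasurableSpace α] :
    MeasurableSpace (Matrix m n α) :=
  (inferInstance : MeasurableSpace (m → n → α))

open Polynomial in
/-- The characteristic polynomial, divided by `X` when `q` is odd. -/
def redPoly {R : Type*} [CommRing R] {q : ℕ} (A : Matrix (Fin q) (Fin q) R) : R[X] :=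
  if Even q then A.charpoly else A.charpoly.divX

/-- The polynomial obstruction. -/
def obst {R : Type*} [CommRing R] {q : ℕ} (s : R) (A : Matrix (Fin q) (Fin q) R) : R :=
  (Polynomial.aeval A (Polynomial.derivative A.charpoly)).det *
    (Polynomial.aeval (s • A) (redPoly A)).det

lemma redPoly_map {R S : Type*} [CommRing R] [CommRing S] {q : ℕ} (f : R →+* S)
    (A : Matrix (Fin q) (Fin q) R) : redPoly (A.map f) = (redPoly A).map f := by
  unfold redPoly
  split_ifs
  · rw [Matrix.charpoly_map]
  · rw [Matrix.charpoly_map]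
    ext n
    simp [Polynomial.coeff_divX]

lemma aeval_map_mat {R S : Type*} [CommRing R] [CommRing S] {q : ℕ} (f : R →+* S)
    (A : Matrix (Fin q) (Fin q) R) (p : Polynomial R) :
    (Polynomial.aeval A p).map f = Polynomial.aeval (A.map f) (p.map f) := by
  have h : f.mapMatrix (Polynomial.aeval A p) = Polynomial.aeval (f.mapMatrix A) (p.map f) := by
    rw [Polynomial.aeval_def, Polynomial.aeval_def, Polynomial.hom_eval₂, Polynomial.eval₂_map]
    congr 1
    ext r i j
    simp [Matrix.algebraMap_matrix_apply]
    split_ifs <;> simp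
  simpa using h

lemma obst_map {R S : Type*} [CommRing R] [CommRing S] {q : ℕ} (f : R →+* S) (s : R)
    (A : Matrix (Fin q) (Fin q) R) : f (obst s A) = obst (f s) (A.map f) := by
  unfold obst
  have h : (f s) • A.map f = (s • A).map f := by ext; simp
  rw [map_mul, RingHom.map_det, RingHom.map_det, RingHom.mapMatrix_apply, RingHom.mapMatrix_apply,
    aeval_map_mat, aeval_map_mat, redPoly_map, Matrix.charpoly_map, Polynomial.derivative_map, h]

lemma obst_continuous {q : ℕ} :
    Continuous (fun x : Matrix (Fin q) (Fin q) ℝ × ℝ => obst x.2 x.1) := by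
  let P : MvPolynomial (Option (Fin q × Fin q)) ℝ :=
    obst (MvPolynomial.X none) (Matrix.of fun i j => MvPolynomial.X (some (i, j)))
  let v : Matrix (Fin q) (Fin q) ℝ × ℝ → Option (Fin q × Fin q) → ℝ :=
    fun x o => o.elim x.2 (fun ij => x.1 ij.1 ij.2)
  have hP : ∀ x, obst x.2 x.1 = MvPolynomial.eval (v x) P := by
    intro x
    rw [obst_map]
    congr 1
    · simp [v]
    · ext i j; simp [v]
  have hv : Continuous v := by
    refine continuous_pi fun o => ?_
    cases o with
    | none => exact continuous_snd
    | some ij => exact (continuous_fst.matrix_elem ij.1 ij.2)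
  simp_rw [hP]
  exact (MvPolynomial.continuous_eval P).comp hv

lemma obst_line {q : ℕ} (s : ℝ) (A B : Matrix (Fin q) (Fin q) ℝ) (h : obst s A ≠ 0) :
    {t : ℝ | obst s (A + t • B) = 0}.Countable := by
  let P : Polynomial ℝ := obst (Polynomial.C s) (A.map Polynomial.C +
    (Polynomial.X : Polynomial ℝ) • B.map Polynomial.C)
  have hP : ∀ t, obst s (A + t • B) = P.eval t := by
    intro t
    change _ = Polynomial.evalRingHom t P
    rw [obst_map]
    congr 1
    · simp
    · ext i j; simp; ring
  have h0 : P ≠ 0 := by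
    intro h0
    apply h
    have := hP 0
    simpa [h0] using this
  refine Set.Finite.countable ((P.roots.toFinset.finite_toSet).subset ?_)
  intro t ht
  simp only [Set.mem_ofPred_eq, hP] at ht
  simp [h0, ht]

lemma det_aeval_eq_zero {q : ℕ} (hq : 2 ≤ q) (A : Matrix (Fin q) (Fin q) ℂ) (p : Polynomial ℂ) :
    (Polynomial.aeval A p).det = 0 ↔ ∃ l, A.charpoly.IsRoot l ∧ p.eval l = 0 := by
  have : Nonempty (Fin q) := ⟨⟨0, by omega⟩⟩
  have h1 : (Polynomial.aeval A p).det = 0 ↔ (0 : ℂ) ∈ spectrum ℂ (Polynomial.aeval A p) := by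
    rw [spectrum.zero_mem_iff, Matrix.isUnit_iff_isUnit_det, isUnit_iff_ne_zero, not_not]
  have hne : (spectrum ℂ A).Nonempty := spectrum.nonempty_of_isAlgClosed_of_finiteDimensional ℂ A
  rw [h1, spectrum.map_polynomial_aeval_of_nonempty A p hne]
  simp [Matrix.mem_spectrum_iff_isRoot_charpoly]

/-- The compact set of parameters. -/
def parSet : Set ℝ := insert 0 (Set.range fun m : {m : ℤ // 2 ≤ |m|} => ((m : ℤ) : ℝ)⁻¹)

lemma parSet_countable : parSet.Countable := (Set.countable_range _).insert 0

lemma parSet_compact : IsCompact parSet := by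
  have h : Filter.Tendsto (fun m : {m : ℤ // 2 ≤ |m|} => ((m : ℤ) : ℝ)⁻¹) Filter.cofinite
      (nhds 0) := by
    have h1 : Filter.Tendsto (fun m : ℤ => (m : ℝ)⁻¹) Filter.cofinite (nhds 0) :=
      Filter.tendsto_inv₀_cobounded.comp (Metric.cobounded_eq_cocompact (α := ℝ) ▸ Int.tendsto_coe_cofinite)
    exact h1.comp Subtype.val_injective.tendsto_cofinite
  exact h.isCompact_insert_range_of_cofinite

lemma charpoly_parity {q : ℕ} (Z : Matrix (Fin q) (Fin q) ℂ) (hZ : Zᵀ = -Z) (x : ℂ) :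
    Z.charpoly.eval (-x) = (-1) ^ q * Z.charpoly.eval x := by
  rw [← Matrix.charpoly_transpose Z, hZ, Matrix.eval_charpoly, ← Matrix.charpoly_transpose, 
    Matrix.transpose_neg, hZ, neg_neg, Matrix.eval_charpoly]
  have : Matrix.scalar (Fin q) (-x) - -Z = - (Matrix.scalar (Fin q) x - Z) := by
    rw [map_neg]; abel
  rw [this, Matrix.det_neg, Fintype.card_fin]

lemma mem_O_iff {q : ℕ} (hq : 2 ≤ q) (Z : Matrix (Fin q) (Fin q) ℝ) (hZ : Zᵀ = -Z) :
    ((eigs Z).toFinset.card = q ∧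
      ∀ lam mu : ℂ, lam ∈ eigs Z → mu ∈ eigs Z →
        lam ≠ mu → lam ≠ 0 → mu ≠ 0 →
        ∀ m : ℤ, 2 ≤ |m| → lam / mu ≠ (m : ℂ)) ↔ ∀ s ∈ parSet, obst s Z ≠ 0 := by
  set A : Matrix (Fin q) (Fin q) ℂ := Z.map (algebraMap ℝ ℂ) with hA
  have hAt : Aᵀ = -A := by
    rw [hA, ← Matrix.transpose_map, hZ]; ext; simp
  have hp0 : A.charpoly ≠ 0 := A.charpoly_monic.ne_zero
  have heigs : eigs Z = A.charpoly.roots := by rw [eigs, hA, Matrix.charpoly_map]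
  have hmem : ∀ l, l ∈ eigs Z ↔ A.charpoly.eval l = 0 := by
    intro l; rw [heigs, Polynomial.mem_roots hp0, Polynomial.IsRoot]
  have hcard : (eigs Z).toFinset.card = q ↔
      ∀ l, A.charpoly.eval l = 0 → (Polynomial.derivative A.charpoly).eval l ≠ 0 := by
    have hc : A.charpoly.roots.card = q := by
      rw [← (IsAlgClosed.splits A.charpoly).natDegree_eq_card_roots,
        Matrix.charpoly_natDegree_eq_dim, Fintype.card_fin]
    have hn : A.charpoly.roots.toFinset.card = q ↔ A.charpoly.roots.Nodup := by
      rw [← Multiset.toFinset_card_eq_card_iff_nodup]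
      exact ⟨fun h => h.trans hc.symm, fun h => h.trans hc⟩
    rw [heigs, hn,
      Multiset.nodup_iff_count_le_one]
    refine forall_congr' fun l => ?_
    rw [Polynomial.count_roots, ← not_lt, Polynomial.one_lt_rootMultiplicity_iff_isRoot hp0]
    simp [Polynomial.IsRoot]
  have hobst : ∀ s : ℝ, obst s Z ≠ 0 ↔
      (∀ l, A.charpoly.eval l = 0 → (Polynomial.derivative A.charpoly).eval l ≠ 0) ∧
      (∀ l, A.charpoly.eval l = 0 → (redPoly A).eval (s * l) ≠ 0) := by
    intro s
    have h1 : obst s Z ≠ 0 ↔ obst (s : ℂ) A ≠ 0 := by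
      have := obst_map (algebraMap ℝ ℂ) s Z
      rw [← hA] at this
      rw [← Complex.coe_algebraMap, ← this]
      simp
    have h2 : Polynomial.aeval ((s : ℂ) • A) (redPoly A) =
        Polynomial.aeval A ((redPoly A).comp (Polynomial.C (s : ℂ) * Polynomial.X)) := by
      rw [Polynomial.aeval_comp]
      simp [Algebra.smul_def]
    rw [h1, obst, mul_ne_zero_iff, h2, Ne, Ne, det_aeval_eq_zero hq, det_aeval_eq_zero hq]
    simp [Polynomial.IsRoot]
  have hred : ∀ x, x ≠ 0 → A.charpoly.eval x = 0 → (redPoly A).eval x = 0 := by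
    intro x hx h
    unfold redPoly
    split_ifs with hev
    · exact h
    · have h0 : A.charpoly.coeff 0 = 0 := by
        have := charpoly_parity A hAt 0
        rw [(Nat.not_even_iff_odd.mp hev).neg_one_pow, neg_zero] at this
        rw [Polynomial.coeff_zero_eq_eval_zero]
        linear_combination this / 2
      rw [← Polynomial.divX_mul_X_add A.charpoly, h0] at h
      simpa [hx] using h
  have hred' : ∀ x, (redPoly A).eval x = 0 → x ≠ 0 → A.charpoly.eval x = 0 := by
    intro x h hx
    unfold redPoly at h
    split_ifs at h with hev
    · exact h
    · have h0 : A.charpoly.coeff 0 = 0 := by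
        have := charpoly_parity A hAt 0
        rw [(Nat.not_even_iff_odd.mp hev).neg_one_pow, neg_zero] at this
        rw [Polynomial.coeff_zero_eq_eval_zero]
        linear_combination this / 2
      rw [← Polynomial.divX_mul_X_add A.charpoly, h0]
      simp [h]
  have hzero : (∀ l, A.charpoly.eval l = 0 → (Polynomial.derivative A.charpoly).eval l ≠ 0) →
      (redPoly A).eval 0 ≠ 0 := by
    intro hd h
    unfold redPoly at h
    split_ifs at h with hev
    · apply hd 0 h
      have hc : A.charpoly.comp (-Polynomial.X) = A.charpoly := by
        apply Polynomial.funext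
        intro x
        have := charpoly_parity A hAt x
        rw [hev.neg_one_pow, one_mul] at this
        simpa using this
      have h3 := congrArg (fun p => (Polynomial.derivative p).eval 0) hc
      simp [Polynomial.derivative_comp] at h3
      linear_combination (-1 / 2) * h3
    · have h0 : A.charpoly.coeff 0 = 0 := by
        have := charpoly_parity A hAt 0
        rw [(Nat.not_even_iff_odd.mp hev).neg_one_pow, neg_zero] at this
        rw [Polynomial.coeff_zero_eq_eval_zero]
        linear_combination this / 2
      apply hd 0
      · rw [← Polynomial.coeff_zero_eq_eval_zero, h0]
      · rw [← Polynomial.divX_mul_X_add A.charpoly, h0]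
        simp [h]
  simp only [hobst, hcard, hmem]
  constructor
  · rintro ⟨hd, hr⟩ s hs
    refine ⟨hd, fun l hl h => ?_⟩
    rcases hs with rfl | ⟨⟨m, hm⟩, rfl⟩
    · apply hzero hd
      simpa using h
    · have hm0 : (m : ℂ) ≠ 0 := by
        rintro h; rw [Int.cast_eq_zero] at h; subst h; norm_num at hm
      simp only [Complex.ofReal_inv, Complex.ofReal_intCast] at h
      by_cases hl0 : l = 0
      · apply hzero hd; simpa [hl0] using h
      · have hmu : (m : ℂ)⁻¹ * l ≠ 0 := mul_ne_zero (inv_ne_zero hm0) hl0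
        refine hr l ((m : ℂ)⁻¹ * l) hl (hred' _ h hmu) ?_ hl0 hmu m hm ?_
        · intro he
          have h1 : (m : ℂ) = 1 := by
            field_simp at he
            exact he
          have : m = 1 := by exact_mod_cast h1
          subst this; norm_num at hm
        · field_simp
  · intro h
    have hd := (h 0 (Set.mem_insert _ _)).1
    refine ⟨hd, fun lam mu hlam hmu _ hlam0 hmu0 m hm he => ?_⟩
    have hm0 : (m : ℂ) ≠ 0 := by
      rintro h; rw [Int.cast_eq_zero] at h; subst h; norm_num at hm
    refine (h (m : ℝ)⁻¹ (Set.mem_insert_of_mem _ ⟨⟨m, hm⟩, rfl⟩)).2 lam hlam ?_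
    have : ((((m : ℝ)⁻¹ : ℝ) : ℂ)) * lam = mu := by
      rw [div_eq_iff hmu0] at he
      rw [he]; push_cast; field_simp
    rw [this]
    exact hred mu hmu0 hmu

lemma null_of_lines {E : Type*} [NormedAddCommGroup E] [NormedSpace ℝ E] [FiniteDimensional ℝ E]
    [MeasurableSpace E] [BorelSpace E] (μ : Measure E) [μ.IsAddHaarMeasure] (B : Set E)
    (hB : IsClosed B) (x : E) (h : ∀ y, {t : ℝ | x + t • y ∈ B}.Countable) : μ B = 0 := by
  let S : Set (E × ℝ) := {z | x + z.2 • z.1 ∈ B}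
  have hS : MeasurableSet S := by
    have : IsClosed S := hB.preimage (by fun_prop : Continuous fun z : E × ℝ => x + z.2 • z.1)
    exact this.measurableSet
  have h0 : (μ.prod volume) S = 0 := by
    rw [Measure.measure_prod_null hS]
    exact Filter.Eventually.of_forall fun y => (h y).measure_zero volume
  have h1 : (volume.prod μ) (Prod.swap ⁻¹' S) = 0 := by
    rw [← Measure.prod_swap, Measure.map_apply measurable_swap hS] at h0
    exact h0
  have h2 := Measure.measure_ae_null_of_prod_null h1
  have h3 : ∀ᵐ t : ℝ, t ≠ 0 := by simp [ae_iff]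
  obtain ⟨t, ht, ht0⟩ := (h2.and h3).exists
  have he : Prod.mk t ⁻¹' (Prod.swap ⁻¹' S) = (fun y => t • y) ⁻¹' ((fun y => x + y) ⁻¹' B) := rfl
  change μ (Prod.mk t ⁻¹' (Prod.swap ⁻¹' S)) = 0 at ht
  rw [he, Measure.addHaar_preimage_smul μ ht0, measure_preimage_add,
    mul_eq_zero] at ht
  rcases ht with ht | ht
  · exfalso
    rw [ENNReal.ofReal_eq_zero] at ht
    have : 0 < |(t ^ Module.finrank ℝ E)⁻¹| := by positivity
    linarith
  · exact ht


/-- let `O` be the set of `Z ∈ so(q,ℝ)` (`q ≥ 2`) with distinct eigenvalues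
such that no ratio of two distinct nonzero eigenvalues is an integer of absolute value
`≥ 2`, and let `W` be a (finite-dimensional) subspace of `so(q,ℝ)` with `W ∩ O ≠ ∅`.
Then `W ∩ O` is open in the subspace topology of `W`, and `W ∖ (W ∩ O)` has measure zero
for every Haar (Lebesgue) measure on the finite-dimensional real vector space `W`. -/
theorem stmt4 (q : ℕ) (hq : 2 ≤ q)
    (O : Set (Matrix (Fin q) (Fin q) ℝ))
    (hO : O = {Z : Matrix (Fin q) (Fin q) ℝ | Zᵀ = -Z ∧
      (eigs Z).toFinset.card = q ∧
      ∀ lam mu : ℂ, lam ∈ eigs Z → mu ∈ eigs Z →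
        lam ≠ mu → lam ≠ 0 → mu ≠ 0 →
        ∀ m : ℤ, 2 ≤ |m| → lam / mu ≠ (m : ℂ)})
    (W : Submodule ℝ (Matrix (Fin q) (Fin q) ℝ))
    (hWskew : ∀ Z ∈ W, Zᵀ = -Z)
    (hWO : ∃ Z : W, (Z : Matrix (Fin q) (Fin q) ℝ) ∈ O) :
    IsOpen {Z : W | (Z : Matrix (Fin q) (Fin q) ℝ) ∈ O} ∧
    (∀ μ : Measure W, μ.IsAddHaarMeasure →
      μ {Z : W | (Z : Matrix (Fin q) (Fin q) ℝ) ∉ O} = 0) := by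
  have hset : ∀ Z : W, (Z : Matrix (Fin q) (Fin q) ℝ) ∈ O ↔
      ∀ s ∈ parSet, obst s (Z : Matrix (Fin q) (Fin q) ℝ) ≠ 0 := by
    intro Z
    rw [hO, ← mem_O_iff hq _ (hWskew _ Z.2)]
    simp only [Set.mem_ofPred_eq, hWskew _ Z.2, true_and]
  have hopen : IsOpen {Z : W | (Z : Matrix (Fin q) (Fin q) ℝ) ∈ O} := by
    rw [isOpen_iff_mem_nhds]
    intro Z hZ
    have hZ' := (hset Z).1 hZ
    have hc : Continuous (fun z : W × ℝ => obst z.2 (z.1 : Matrix (Fin q) (Fin q) ℝ)) :=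
      obst_continuous.comp ((continuous_subtype_val.comp continuous_fst).prodMk continuous_snd)
    have := parSet_compact.eventually_forall_of_forall_eventually (x₀ := Z)
      (P := fun (Y : W) (s : ℝ) => obst s (Y : Matrix (Fin q) (Fin q) ℝ) ≠ 0)
      (fun s hs => hc.continuousAt.eventually_ne (hZ' s hs))
    filter_upwards [this] with Y hY
    exact (hset Y).2 hY
  refine ⟨hopen, fun μ hμ => ?_⟩
  obtain ⟨Z₀, hZ₀⟩ := hWO
  let : NormedAddCommGroup (Matrix (Fin q) (Fin q) ℝ) := Matrix.normedAddCommGroup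
  let : NormedSpace ℝ (Matrix (Fin q) (Fin q) ℝ) := Matrix.normedSpace
  have : BorelSpace (Matrix (Fin q) (Fin q) ℝ) :=
    (inferInstance : BorelSpace (Fin q → Fin q → ℝ))
  have hb : BorelSpace W := Subtype.borelSpace _
  refine @null_of_lines W _ _ _ _ hb μ hμ _ hopen.isClosed_compl Z₀ fun Y => ?_
  have hcount := parSet_countable.biUnion fun s hs =>
    obst_line s (Z₀ : Matrix (Fin q) (Fin q) ℝ) Y ((hset Z₀).1 hZ₀ s hs)
  refine hcount.mono fun t ht => ?_
  have ht' : ¬ (((Z₀ + t • Y : W) : Matrix (Fin q) (Fin q) ℝ) ∈ O) := ht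
  rw [hset] at ht'
  push Not at ht'
  obtain ⟨s, hs, h⟩ := ht'
  exact Set.mem_biUnion hs h
end
end

section
/- Let q ≥ 2 and let m be an integer with |m| ≥ 2. Let A_m be the set of Z ∈ so(q,ℝ) such that the eigenvalues of Z are distinct (the characteristic polynomial of Z has q distinct roots in ℂ) and such that for any two distinct nonzero eigenvalues λ, μ of Z one has λ/μ ≠ m. Then A_m is a nonempty Zariski open subset of so(q,ℝ). -/
open Matrix

noncomputable section

/-- The real vector space `so(q,ℝ)` of `q × q` real skew-symmetric matrices. -/
def so (q : ℕ) : Submodule ℝ (Matrix (Fin q) (Fin q) ℝ) where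
  carrier := {Z | Zᵀ = -Z}
  add_mem' := by
    intro a b ha hb
    simp only [Set.mem_setOf_eq] at *
    rw [Matrix.transpose_add, ha, hb, neg_add]
  zero_mem' := by
    simp only [Set.mem_setOf_eq, Matrix.transpose_zero, neg_zero]
  smul_mem' := by
    intro c a ha
    simp only [Set.mem_setOf_eq] at *
    rw [Matrix.transpose_smul, ha, smul_neg]

/-- The algebra `K[V]` of polynomial functions on a `K`-vector space `V`: the `K`-subalgebra
of all functions `V → K` generated by the dual space `V*`. -/
def polyFuns (K V : Type*) [Field K] [AddCommGroup V] [Module K V] :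
    Subalgebra K (V → K) :=
  Algebra.adjoin K {f : V → K | ∃ T : V →ₗ[K] K, f = ⇑T}

/-- A subset `A` of a `K`-vector space `V` is Zariski closed if it is the common zero set
of finitely many polynomial functions on `V`. -/
def IsZariskiClosed (K : Type*) {V : Type*} [Field K] [AddCommGroup V] [Module K V]
    (A : Set V) : Prop :=
  ∃ (n : ℕ) (g : Fin n → (V → K)), (∀ i, g i ∈ polyFuns K V) ∧
    A = {v : V | ∀ i, g i v = 0}

/-- A subset of a `K`-vector space is Zariski open if its complement is Zariski closed. -/
def IsZariskiOpen (K : Type*) {V : Type*} [Field K] [AddCommGroup V] [Module K V]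
    (A : Set V) : Prop :=
  IsZariskiClosed K Aᶜ

/-- The generic matrix over the ring of polynomial functions. -/
def genMat (q : ℕ) : Matrix (Fin q) (Fin q) (polyFuns ℝ (so q)) :=
  fun i j => ⟨fun Z => (Z : Matrix (Fin q) (Fin q) ℝ) i j,
    Algebra.subset_adjoin ⟨{ toFun := fun Z => (Z : Matrix (Fin q) (Fin q) ℝ) i j
                             map_add' := fun _ _ => rfl
                             map_smul' := fun _ _ => rfl }, rfl⟩⟩

/-- Evaluation at a point, into the complex numbers. -/
def evC (q : ℕ) (Z : so q) : polyFuns ℝ (so q) →+* ℂ :=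
  (algebraMap ℝ ℂ).comp ((Pi.evalRingHom (fun _ : so q => ℝ) Z).comp (polyFuns ℝ (so q)).val.toRingHom)

/-- The complexification of a real matrix. -/
def cMat {q : ℕ} (Z : so q) : Matrix (Fin q) (Fin q) ℂ :=
  (Z : Matrix (Fin q) (Fin q) ℝ).map (algebraMap ℝ ℂ)

lemma evC_apply {q : ℕ} (Z : so q) (f : polyFuns ℝ (so q)) : evC q Z f = ((f.1 Z : ℝ) : ℂ) := rfl

lemma genMat_map {q : ℕ} (Z : so q) : (genMat q).map (evC q Z) = cMat Z := rfl

lemma mem_eigs {q : ℕ} (Z : so q) (x : ℂ) :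
    x ∈ eigs (Z : Matrix (Fin q) (Fin q) ℝ) ↔ (cMat Z).charpoly.IsRoot x := by
  unfold eigs cMat
  rw [← Matrix.charpoly_map, Polynomial.mem_roots (Matrix.charpoly_monic _).ne_zero]

lemma eigs_eq {q : ℕ} (Z : so q) :
    eigs (Z : Matrix (Fin q) (Fin q) ℝ) = (cMat Z).charpoly.roots := by
  unfold eigs cMat
  rw [← Matrix.charpoly_map]

lemma eigs_card {q : ℕ} (Z : so q) :
    Multiset.card (eigs (Z : Matrix (Fin q) (Fin q) ℝ)) = q := by
  rw [eigs_eq, IsAlgClosed.card_roots_eq_natDegree, Matrix.charpoly_natDegree_eq_dim,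
    Fintype.card_fin]

lemma card_iff {q : ℕ} (Z : so q) :
    (eigs (Z : Matrix (Fin q) (Fin q) ℝ)).toFinset.card = q ↔
      ∀ x, (cMat Z).charpoly.IsRoot x → ¬ (cMat Z).charpoly.derivative.IsRoot x := by
  have h : (eigs (Z : Matrix (Fin q) (Fin q) ℝ)).toFinset.card = q ↔
      (eigs (Z : Matrix (Fin q) (Fin q) ℝ)).Nodup := by
    rw [← Multiset.toFinset_card_eq_card_iff_nodup, eigs_card]
  rw [h, eigs_eq, Multiset.nodup_iff_count_le_one]
  refine forall_congr' fun x => ?_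
  rw [Polynomial.count_roots, ← not_lt,
    Polynomial.one_lt_rootMultiplicity_iff_isRoot (Matrix.charpoly_monic _).ne_zero]
  tauto

lemma det_aeval_ne {q : ℕ} (hq : 2 ≤ q) (M : Matrix (Fin q) (Fin q) ℂ) (s : Polynomial ℂ) :
    (Polynomial.aeval M s).det ≠ 0 ↔ ∀ x, M.charpoly.IsRoot x → ¬ s.IsRoot x := by
  have : Nonempty (Fin q) := ⟨⟨0, by omega⟩⟩
  have h1 : (Polynomial.aeval M s).det ≠ 0 ↔ (0 : ℂ) ∉ spectrum ℂ (Polynomial.aeval M s) := by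
    rw [spectrum.zero_notMem_iff, Matrix.isUnit_iff_isUnit_det, isUnit_iff_ne_zero]
  rw [h1, spectrum.map_polynomial_aeval_of_nonempty M s (spectrum.nonempty_of_isAlgClosed_of_finiteDimensional ℂ M)]
  simp only [Set.mem_image, Matrix.mem_spectrum_iff_isRoot_charpoly, Polynomial.IsRoot.def]
  push Not
  rfl

lemma map_det_aeval {q : ℕ} (Z : so q) (s : Polynomial (polyFuns ℝ (so q))) :
    evC q Z (Polynomial.aeval (genMat q) s).det = (Polynomial.aeval (cMat Z) (s.map (evC q Z))).det := by
  rw [RingHom.map_det]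
  congr 1
  rw [Polynomial.aeval_def, Polynomial.hom_eval₂, Polynomial.aeval_def, Polynomial.eval₂_map]
  congr 1
  ext r i j
  simp [Matrix.algebraMap_matrix_apply]
  split_ifs <;> simp

lemma charpoly_symm {q : ℕ} (Z : so q) (x : ℂ) :
    (cMat Z).charpoly.eval (-x) = (-1) ^ q * (cMat Z).charpoly.eval x := by
  have hZ : (cMat Z)ᵀ = - cMat Z := by
    have : (Z : Matrix (Fin q) (Fin q) ℝ)ᵀ = - (Z : Matrix (Fin q) (Fin q) ℝ) := Z.2
    unfold cMat
    rw [← Matrix.transpose_map, this]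
    ext; simp
  rw [Matrix.eval_charpoly, Matrix.eval_charpoly, ← Matrix.det_transpose (_ - _),
    Matrix.transpose_sub, hZ]
  have : (Matrix.scalar (Fin q) (-x))ᵀ - -cMat Z = - (Matrix.scalar (Fin q) x - cMat Z) := by
    ext i j; simp [Matrix.diagonal_apply]; split_ifs <;> simp_all <;> ring
  rw [this, Matrix.det_neg, Fintype.card_fin]

lemma charpoly_comp {q : ℕ} (Z : so q) :
    (cMat Z).charpoly.comp (-Polynomial.X) = Polynomial.C ((-1) ^ q) * (cMat Z).charpoly := by
  apply Polynomial.funext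
  intro x
  rw [Polynomial.eval_comp, Polynomial.eval_mul, Polynomial.eval_C, Polynomial.eval_neg,
    Polynomial.eval_X, charpoly_symm]

lemma odd_root {q : ℕ} (hq : Odd q) (Z : so q) : (cMat Z).charpoly.IsRoot 0 := by
  have := charpoly_symm Z 0
  rw [hq.neg_one_pow, neg_zero] at this
  rw [Polynomial.IsRoot.def]
  linear_combination this / 2

lemma even_deriv {q : ℕ} (hq : Even q) (Z : so q) : (cMat Z).charpoly.derivative.IsRoot 0 := by
  have := congrArg (fun p => (Polynomial.derivative p).eval 0) (charpoly_comp Z)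
  simp only [Polynomial.derivative_comp, hq.neg_one_pow] at this
  simp at this
  rw [Polynomial.IsRoot.def]
  linear_combination (-1 / 2) * this

/-- The polynomial playing the role of the characteristic polynomial with 0 removed. -/
def redP {R : Type*} [CommRing R] {q : ℕ} (M : Matrix (Fin q) (Fin q) R) : Polynomial R :=
  if Even q then M.charpoly else M.charpoly.divX

lemma redP_map {q : ℕ} (Z : so q) : (redP (genMat q)).map (evC q Z) = redP (cMat Z) := by
  unfold redP
  rw [← genMat_map]
  split_ifs
  · rw [Matrix.charpoly_map]
  · rw [Matrix.charpoly_map]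
    ext n
    simp [Polynomial.coeff_divX]

lemma redP_root {q : ℕ} (Z : so q)
    (h : ∀ x, (cMat Z).charpoly.IsRoot x → ¬ (cMat Z).charpoly.derivative.IsRoot x) (x : ℂ) :
    (redP (cMat Z)).IsRoot x ↔ (cMat Z).charpoly.IsRoot x ∧ x ≠ 0 := by
  unfold redP
  split_ifs with hq
  · refine ⟨fun hx => ⟨hx, ?_⟩, fun hx => hx.1⟩
    rintro rfl
    exact h 0 hx (even_deriv hq Z)
  · have h0 := odd_root (Nat.not_even_iff_odd.mp hq) Z
    have hd : (cMat Z).charpoly = (cMat Z).charpoly.divX * Polynomial.X := by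
      conv_lhs => rw [← Polynomial.divX_mul_X_add (cMat Z).charpoly]
      rw [Polynomial.coeff_zero_eq_eval_zero, h0]; simp
    constructor
    · intro hx
      refine ⟨?_, ?_⟩
      · rw [hd, Polynomial.IsRoot.def, Polynomial.eval_mul, hx, zero_mul]
      · rintro rfl
        apply h 0 h0
        rw [hd, Polynomial.IsRoot.def, Polynomial.derivative_mul]
        simpa using hx
    · rintro ⟨hx, hx0⟩
      rw [hd, Polynomial.IsRoot.def, Polynomial.eval_mul, Polynomial.eval_X] at hx
      exact (mul_eq_zero.mp hx).resolve_right hx0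

/-- The entries of the example. -/
def exA (q : ℕ) (i : Fin q) : ℤ :=
  if 2 * (i : ℤ) + 1 < q then q + (q - 1 - 2 * (i : ℤ))
  else if (q : ℤ) < 2 * (i : ℤ) + 1 then (q - 1 - 2 * (i : ℤ)) - q else 0

lemma exA_rev {q : ℕ} (i : Fin q) : exA q i.rev = - exA q i := by
  have := i.2
  have h : ((i.rev : ℕ) : ℤ) = q - (i + 1) := by rw [Fin.val_rev]; omega
  unfold exA
  rw [h]
  split_ifs <;> omega

lemma exA_inj (q : ℕ) : Function.Injective (exA q) := by
  intro i j h
  have := i.2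
  have := j.2
  unfold exA at h
  ext
  split_ifs at h <;> omega

lemma exA_lt {q : ℕ} (i : Fin q) : |exA q i| < 2 * q := by
  have := i.2
  rw [abs_lt]
  unfold exA
  split_ifs <;> omega

lemma exA_gt {q : ℕ} (i : Fin q) (h : exA q i ≠ 0) : (q : ℤ) < |exA q i| := by
  have := i.2
  rw [lt_abs]
  unfold exA at *
  split_ifs at * <;> omega

/-- The example. -/
def exZ (q : ℕ) : so q :=
  ⟨Matrix.of fun i j => if j = i.rev then (exA q i : ℝ) else 0, by
    change Matrix.transpose _ = _
    ext i j
    simp only [Matrix.transpose_apply, Matrix.neg_apply, Matrix.of_apply]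
    by_cases h : j = i.rev
    · subst h
      simp [exA_rev]
    · have : ¬ i = j.rev := by rintro rfl; simp at h
      simp [h, this]⟩

lemma exZ_root {q : ℕ} (i : Fin q) : (cMat (exZ q)).charpoly.IsRoot (Complex.I * exA q i) := by
  rw [Polynomial.IsRoot.def, Matrix.eval_charpoly, ← Matrix.exists_mulVec_eq_zero_iff]
  refine ⟨fun k => (if k = i then 1 else 0) + Complex.I * (if k = i.rev then 1 else 0), ?_, ?_⟩
  · intro h
    have := congrFun h i
    have := congrArg Complex.re this
    by_cases h : i = i.rev
    · rw [← h] at this; simp at this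
    · simp [h] at this
  · rw [Matrix.sub_mulVec, sub_eq_zero]
    ext k
    have hL : (Matrix.scalar (Fin q) (Complex.I * (exA q i : ℂ)) *ᵥ
      fun k => (if k = i then 1 else 0) + Complex.I * (if k = i.rev then 1 else 0)) k =
      Complex.I * (exA q i : ℂ) * ((if k = i then 1 else 0) + Complex.I * (if k = i.rev then 1 else 0)) := by
      simp [Matrix.mulVec_diagonal]
    have hR : (cMat (exZ q) *ᵥ
      fun k => (if k = i then 1 else 0) + Complex.I * (if k = i.rev then 1 else 0)) k =
      exA q k * ((if k.rev = i then 1 else 0) + Complex.I * (if k.rev = i.rev then 1 else 0)) := by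
      rw [Matrix.mulVec, dotProduct, Finset.sum_eq_single k.rev]
      · simp [cMat, exZ]
      · intro b _ hb
        simp [cMat, exZ, hb]
      · simp
    rw [hL, hR]
    have e1 : (k.rev = i) = (k = i.rev) := by
      apply propext; constructor <;> (rintro rfl; simp)
    simp only [e1, Fin.rev_inj]
    by_cases h1 : k = i
    · by_cases h2 : k = i.rev
      · have h3 := exA_rev i
        rw [← h2, h1] at h3
        have h4 : exA q i = 0 := by omega
        rw [h1, h4]; simp
      · subst h1; simp [h2]; ring
    · by_cases h2 : k = i.rev
      · subst h2
        simp [h1, exA_rev]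
        linear_combination (exA q i : ℂ) * Complex.I_mul_I
      · simp [h1, h2]

lemma exZ_eigs (q : ℕ) : (eigs (exZ q : Matrix (Fin q) (Fin q) ℝ)).toFinset.card = q ∧
    ∀ x ∈ eigs (exZ q : Matrix (Fin q) (Fin q) ℝ), ∃ i, x = Complex.I * exA q i := by
  have hinj : Function.Injective (fun i : Fin q => Complex.I * (exA q i : ℂ)) := by
    intro i j h
    apply exA_inj
    simpa using h
  have hc : (Finset.univ.image (fun i : Fin q => Complex.I * (exA q i : ℂ))).card = q := by
    rw [Finset.card_image_of_injective _ hinj, Finset.card_univ, Fintype.card_fin]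
  have hs : Finset.univ.image (fun i : Fin q => Complex.I * (exA q i : ℂ)) ⊆
      (eigs (exZ q : Matrix (Fin q) (Fin q) ℝ)).toFinset := by
    intro x hx
    obtain ⟨i, -, rfl⟩ := Finset.mem_image.mp hx
    rw [Multiset.mem_toFinset, mem_eigs]
    exact exZ_root i
  have hle : (eigs (exZ q : Matrix (Fin q) (Fin q) ℝ)).toFinset.card ≤ q :=
    (Multiset.toFinset_card_le _).trans (eigs_card _).le
  have he := Finset.eq_of_subset_of_card_le hs (by rw [hc]; exact hle)
  refine ⟨by rw [← he, hc], fun x hx => ?_⟩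
  rw [← Multiset.mem_toFinset, ← he] at hx
  obtain ⟨i, -, rfl⟩ := Finset.mem_image.mp hx
  exact ⟨i, rfl⟩

/-- for `q ≥ 2` and an integer `m` with `|m| ≥ 2`, the set `A_m` of
`Z ∈ so(q,ℝ)` with distinct eigenvalues such that no ratio of two distinct nonzero
eigenvalues equals `m` is a nonempty Zariski open subset of `so(q,ℝ)`. -/
theorem stmt18 (q : ℕ) (hq : 2 ≤ q) (m : ℤ) (hm : 2 ≤ |m|)
    (Am : Set (so q))
    (hAm : Am = {Z : so q | (eigs (Z : Matrix (Fin q) (Fin q) ℝ)).toFinset.card = q ∧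
      ∀ lam mu : ℂ, lam ∈ eigs (Z : Matrix (Fin q) (Fin q) ℝ) →
        mu ∈ eigs (Z : Matrix (Fin q) (Fin q) ℝ) →
        lam ≠ mu → lam ≠ 0 → mu ≠ 0 → lam / mu ≠ (m : ℂ)}) :
    Am.Nonempty ∧ IsZariskiOpen ℝ Am := by
  have hm1 : (m : ℂ) ≠ 1 := by
    intro h
    have : m = 1 := by exact_mod_cast h
    subst this; norm_num at hm
  have hm0 : (m : ℂ) ≠ 0 := by
    intro h
    have : m = 0 := by exact_mod_cast h
    subst this; norm_num at hm
  subst hAm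
  constructor
  · refine ⟨exZ q, (exZ_eigs q).1, ?_⟩
    intro lam mu hl hmu _ _ hmu0 hdiv
    obtain ⟨i, rfl⟩ := (exZ_eigs q).2 _ hl
    obtain ⟨j, rfl⟩ := (exZ_eigs q).2 _ hmu
    rw [div_eq_iff hmu0] at hdiv
    have h1 : (exA q i : ℂ) = m * exA q j := by
      apply mul_left_cancel₀ Complex.I_ne_zero
      rw [hdiv]; ring
    have h2 : exA q i = m * exA q j := by exact_mod_cast h1
    have h3 : exA q j ≠ 0 := by
      intro h; apply hmu0; simp [h]
    have h4 := exA_gt j h3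
    have h5 := exA_lt i
    rw [h2, abs_mul] at h5
    nlinarith
  · let G : polyFuns ℝ (so q) :=
      (Polynomial.aeval (genMat q) (genMat q).charpoly.derivative).det
    let H : polyFuns ℝ (so q) :=
      (Polynomial.aeval (genMat q) ((redP (genMat q)).comp
        (Polynomial.C (m : polyFuns ℝ (so q)) * Polynomial.X))).det
    refine ⟨1, fun _ => (G * H).1, fun _ => (G * H).2, ?_⟩
    ext Z
    rw [Set.mem_compl_iff, not_iff_comm]
    have hG : evC q Z G ≠ 0 ↔
        ∀ x, (cMat Z).charpoly.IsRoot x → ¬ (cMat Z).charpoly.derivative.IsRoot x := by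
      simp only [G]
      rw [map_det_aeval, ← Polynomial.derivative_map, ← Matrix.charpoly_map, genMat_map,
        det_aeval_ne hq]
    have hH : evC q Z H ≠ 0 ↔
        ∀ x, (cMat Z).charpoly.IsRoot x → ¬ (redP (cMat Z)).IsRoot (m * x) := by
      simp only [H]
      rw [map_det_aeval, Polynomial.map_comp, redP_map, det_aeval_ne hq]
      simp [Polynomial.IsRoot.def, Polynomial.eval_comp]
    have hGH : (¬ Z ∈ {v : so q | ∀ _ : Fin 1, (G * H).1 v = 0}) ↔
        evC q Z G ≠ 0 ∧ evC q Z H ≠ 0 := by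
      rw [← mul_ne_zero_iff, ← map_mul, evC_apply]
      simp
    rw [hGH, hG, hH, Set.mem_setOf_eq, card_iff]
    refine and_congr_right fun hsep => ?_
    simp only [mem_eigs, redP_root Z hsep]
    constructor
    · intro h lam mu hl hmu _ hl0 hmu0 hdiv
      rw [div_eq_iff hmu0] at hdiv
      exact h mu hmu (hdiv ▸ ⟨hl, hl0⟩)
    · rintro h x hx ⟨hmx, hmx0⟩
      have hx0 : x ≠ 0 := right_ne_zero_of_mul hmx0
      refine h _ _ hmx hx ?_ hmx0 hx0 (mul_div_cancel_right₀ _ hx0)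
      intro he
      apply hm1
      apply mul_right_cancel₀ hx0
      rw [he, one_mul]
end
end
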